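/- (Stability of the supremum of subsolutions.) Assume j(·,z) is continuous on ℝ^d for every z. Let A be a nonempty set and (F_a)_{a∈A} a family of continuous degenerate elliptic functions ℝ^d×ℝ×ℝ^d×S^d×ℝ→ℝ that is uniformly bounded on every compact set, and let (u_a)_{a∈A} be a family of bounded usc viscosity subsolutions of F_a(x,w,∇w,D²w,I_LI[x,w]) = 0 on ℝ^d such that there is a constant c̄' with u_a(x) ≤ c̄' for all a∈A and x∈ℝ^d. Let u := sup_{a∈A} u_a, let u* be its upper semicontinuous envelope, and let F̲ be the lower semicontinuous envelope of inf_{a∈A} F_a (which is finite by the uniform local boundedness). Then u* is a viscosity subsolution of F̲(x,w,∇w,D²w,I_LI[x,w]) = 0, i.e. for every bounded C² function φ:ℝ^d→ℝ and every global maximum point x of u*−φ one has F̲(x,u*(x),∇φ(x),D²φ(x),I_LI[x,φ]) ≤ 0. -/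

import Mathlib

open scoped RealInnerProductSpace
open Filter Metric MeasureTheory Topology

/-- The Lévy–Itô operator `I_LI[x,φ]`. -/
noncomputable def ILI {d : ℕ} (μ : Measure (EuclideanSpace ℝ (Fin d)))
    (j : EuclideanSpace ℝ (Fin d) → EuclideanSpace ℝ (Fin d) → EuclideanSpace ℝ (Fin d))
    (x : EuclideanSpace ℝ (Fin d)) (φ : EuclideanSpace ℝ (Fin d) → ℝ) : ℝ :=
  ∫ z, (φ (x + j x z) - φ x -
    ⟪gradient φ x, j x z⟫ *
      (closedBall (0 : EuclideanSpace ℝ (Fin d)) 1).indicator (fun _ => (1:ℝ)) z) ∂μ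

/-- The Hessian matrix of `φ` at `x`. -/
noncomputable def hessM {d : ℕ} (φ : EuclideanSpace ℝ (Fin d) → ℝ)
    (x : EuclideanSpace ℝ (Fin d)) : Matrix (Fin d) (Fin d) ℝ :=
  Matrix.of fun i j =>
    iteratedFDeriv ℝ 2 φ x ![EuclideanSpace.single i 1, EuclideanSpace.single j 1]

/-- Degenerate ellipticity of `F`. -/
def DegEll {d : ℕ}
    (F : EuclideanSpace ℝ (Fin d) → ℝ → EuclideanSpace ℝ (Fin d) →
      Matrix (Fin d) (Fin d) ℝ → ℝ → ℝ) : Prop :=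
  ∀ x u p (M N : Matrix (Fin d) (Fin d) ℝ) (l₁ l₂ : ℝ),
    (M - N).PosSemidef → l₂ ≤ l₁ → F x u p M l₁ ≤ F x u p N l₂

/-- Viscosity subsolution (bounded usc functions, bounded `C²` test functions). -/
def IsSubsolution {d : ℕ}
    (F : EuclideanSpace ℝ (Fin d) → ℝ → EuclideanSpace ℝ (Fin d) →
      Matrix (Fin d) (Fin d) ℝ → ℝ → ℝ)
    (μ : Measure (EuclideanSpace ℝ (Fin d)))
    (j : EuclideanSpace ℝ (Fin d) → EuclideanSpace ℝ (Fin d) → EuclideanSpace ℝ (Fin d))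
    (u : EuclideanSpace ℝ (Fin d) → ℝ) : Prop :=
  ∀ φ : EuclideanSpace ℝ (Fin d) → ℝ, ContDiff ℝ 2 φ → (∃ C, ∀ y, |φ y| ≤ C) →
    ∀ x : EuclideanSpace ℝ (Fin d), (∀ y, u y - φ y ≤ u x - φ x) →
      F x (u x) (gradient φ x) (hessM φ x) (ILI μ j x φ) ≤ 0

/-- Viscosity supersolution. -/
def IsSupersolution {d : ℕ}
    (F : EuclideanSpace ℝ (Fin d) → ℝ → EuclideanSpace ℝ (Fin d) →
      Matrix (Fin d) (Fin d) ℝ → ℝ → ℝ)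
    (μ : Measure (EuclideanSpace ℝ (Fin d)))
    (j : EuclideanSpace ℝ (Fin d) → EuclideanSpace ℝ (Fin d) → EuclideanSpace ℝ (Fin d))
    (v : EuclideanSpace ℝ (Fin d) → ℝ) : Prop :=
  ∀ φ : EuclideanSpace ℝ (Fin d) → ℝ, ContDiff ℝ 2 φ → (∃ C, ∀ y, |φ y| ≤ C) →
    ∀ x : EuclideanSpace ℝ (Fin d), (∀ y, v x - φ x ≤ v y - φ y) →
      F x (v x) (gradient φ x) (hessM φ x) (ILI μ j x φ) ≥ 0

/-- A strict perturbation of a test function touching a relaxed supremum from above touches some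
member of the family from above, at a nearby point and with a nearby value. -/
theorem exists_isMax_sub_perturbation {X ι : Type*} [PseudoMetricSpace X] [ProperSpace X]
    {u : ι → X → ℝ} {U φ η : X → ℝ} {x : X} (hu : ∀ i, UpperSemicontinuous (u i))
    (hle : ∀ i y, u i y ≤ U y) (happ : ∀ ε > 0, ∃ᶠ y in 𝓝 x, ∃ i, U x - ε < u i y)
    (hφ : Continuous φ) (hη : Continuous η) (hη0 : ∀ y, 0 ≤ η y) (hηx : η x = 0)
    (hηpos : ∀ r > 0, ∃ m > 0, ∀ y, r ≤ dist y x → m ≤ η y)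
    (hmax : ∀ y, U y - φ y ≤ U x - φ x) {δ ε : ℝ} (hδ : 0 < δ) (hε : 0 < ε) :
    ∃ i x', dist x' x < ε ∧ |u i x' - U x| < ε ∧
      ∀ y, u i y - (φ y + δ * η y) ≤ u i x' - (φ x' + δ * η x') := by
  obtain ⟨r₀, hr₀, hφr⟩ := Metric.continuousAt_iff.1 (hφ.continuousAt (x := x)) (ε / 2) (half_pos hε)
  obtain ⟨r, hr, hrr⟩ : ∃ r > 0, r < ε ∧ r < r₀ := by
    obtain ⟨r, hr, hr'⟩ := exists_between (lt_min hε hr₀)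
    exact ⟨r, hr, lt_min_iff.1 hr'⟩
  obtain ⟨m, hm, hmη⟩ := hηpos r hr
  obtain ⟨κ, hκ, hκε, hκm⟩ : ∃ κ > 0, κ ≤ ε / 2 ∧ κ ≤ δ * m :=
    ⟨min (ε / 2) (δ * m), lt_min (half_pos hε) (mul_pos hδ hm), min_le_left _ _, min_le_right _ _⟩
  have h1 : ∀ᶠ y in 𝓝 x, φ y + δ * η y < φ x + κ / 2 := by
    have : Continuous fun y => φ y + δ * η y := by fun_prop
    refine this.continuousAt.eventually_lt continuousAt_const ?_
    rw [hηx]; linarith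
  obtain ⟨y, ⟨i, hi⟩, hy, hyr⟩ :=
    ((happ (κ / 2) (half_pos hκ)).and_eventually (h1.and (ball_mem_nhds x hr))).exists
  have husc : UpperSemicontinuousOn (fun y => u i y + -(φ y + δ * η y)) (closedBall x r) :=
    ((hu i).add (Continuous.upperSemicontinuous (by fun_prop))).upperSemicontinuousOn _
  obtain ⟨x', hx', hxmax⟩ := husc.exists_isMaxOn ⟨y, ball_subset_closedBall hyr⟩
    (isCompact_closedBall x r)
  have hyx := hxmax (ball_subset_closedBall hyr)
  simp only [Set.mem_ofPred_eq] at hyx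
  refine ⟨i, x', (mem_closedBall.1 hx').trans_lt hrr.1, ?_, fun z => ?_⟩
  · have hd := hφr ((mem_closedBall.1 hx').trans_lt hrr.2)
    rw [Real.dist_eq, abs_lt] at hd
    have h2 := mul_nonneg hδ.le (hη0 x')
    have h3 := hle i x'
    have h4 := hmax x'
    rw [abs_lt]
    constructor <;> linarith
  · by_cases hz : z ∈ closedBall x r
    · have := hxmax hz
      simp only [Set.mem_ofPred_eq] at this
      linarith
    · have h2 := mul_le_mul_of_nonneg_left (hmη z (not_le.1 hz).le) hδ.le
      have h3 := hle i z
      have h4 := hmax z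
      linarith

/-- A bounded smooth function of `y` which vanishes exactly at `x`. -/
noncomputable def smoothPenalty {E : Type*} [NormedAddCommGroup E] (x y : E) : ℝ :=
  ‖y - x‖ ^ 2 / (1 + ‖y - x‖ ^ 2)

section smoothPenalty

variable {E : Type*} [NormedAddCommGroup E]

theorem smoothPenalty_self (x : E) : smoothPenalty x x = 0 := by simp [smoothPenalty]

theorem smoothPenalty_nonneg (x y : E) : 0 ≤ smoothPenalty x y := by
  unfold smoothPenalty; positivity

theorem abs_smoothPenalty_le_one (x y : E) : |smoothPenalty x y| ≤ 1 := by
  rw [abs_of_nonneg (smoothPenalty_nonneg x y), smoothPenalty, div_le_one (by positivity)]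
  linarith

theorem le_smoothPenalty {x y : E} {r : ℝ} (hr : 0 ≤ r) (h : r ≤ dist y x) :
    r ^ 2 / (1 + r ^ 2) ≤ smoothPenalty x y := by
  rw [dist_eq_norm] at h
  have : r ^ 2 ≤ ‖y - x‖ ^ 2 := pow_le_pow_left₀ hr h 2
  rw [smoothPenalty, div_le_div_iff₀ (by positivity) (by positivity)]
  nlinarith

theorem contDiff_smoothPenalty [InnerProductSpace ℝ E] {n : WithTop ℕ∞} (x : E) :
    ContDiff ℝ n (smoothPenalty x) := by
  have h : ContDiff ℝ n fun y : E => ‖y - x‖ ^ 2 := (contDiff_id.sub contDiff_const).norm_sq ℝ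
  exact h.div (contDiff_const.add h) fun y => by positivity

end smoothPenalty

/-- The second-order Taylor estimate for a `C²` function, uniform on a closed ball. -/
theorem exists_taylor_bound_closedBall {E F : Type*} [NormedAddCommGroup E] [NormedSpace ℝ E]
    [ProperSpace E] [NormedAddCommGroup F] [NormedSpace ℝ F]
    {φ : E → F} (hφ : ContDiff ℝ 2 φ) (x : E) (R : ℝ) :
    ∃ C, 0 ≤ C ∧ ∀ y ∈ closedBall x R, ∀ h, y + h ∈ closedBall x R →
      ‖φ (y + h) - φ y - fderiv ℝ φ y h‖ ≤ C * ‖h‖ ^ 2 := by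
  have hd : ContDiff ℝ 1 (fderiv ℝ φ) := hφ.fderiv_right (by norm_num)
  have hdd : Continuous fun y => fderiv ℝ (fderiv ℝ φ) y := hd.continuous_fderiv (by norm_num)
  obtain ⟨C, hC⟩ : ∃ C, ∀ y ∈ closedBall x R, ‖fderiv ℝ (fderiv ℝ φ) y‖ ≤ C :=
    (isCompact_closedBall x R).exists_bound_of_continuousOn
      (E := E →L[ℝ] E →L[ℝ] F) hdd.continuousOn
  have hC' : ∀ y ∈ closedBall x R, ‖fderiv ℝ (fderiv ℝ φ) y‖ ≤ |C| :=
    fun y hy => (hC y hy).trans (le_abs_self C)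
  refine ⟨|C|, abs_nonneg C, fun y hy h hyh => ?_⟩
  have hseg : segment ℝ y (y + h) ⊆ closedBall x R := (convex_closedBall x R).segment_subset hy hyh
  have key := Convex.norm_image_sub_le_of_norm_fderiv_le' (𝕜 := ℝ) (f := φ)
    (φ := fderiv ℝ φ y) (C := |C| * ‖h‖) (s := segment ℝ y (y + h)) (x := y) (y := y + h)
    (fun z _ => (hφ.differentiable (by norm_num)).differentiableAt)
    (fun z hz => ?_) (convex_segment _ _) (left_mem_segment _ _ _) (right_mem_segment _ _ _)
  · rw [add_sub_cancel_left] at key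
    exact key.trans_eq (by ring)
  · have h1 := (convex_closedBall x R).norm_image_sub_le_of_norm_fderiv_le (𝕜 := ℝ)
      (fun w _ => (hd.differentiable (by norm_num)).differentiableAt) hC' hy (hseg hz)
    refine h1.trans (mul_le_mul_of_nonneg_left ?_ (abs_nonneg C))
    simpa using norm_sub_le_of_mem_segment hz

section LevyIto

variable {d : ℕ} {μ : Measure (EuclideanSpace ℝ (Fin d))}
  {j : EuclideanSpace ℝ (Fin d) → EuclideanSpace ℝ (Fin d) → EuclideanSpace ℝ (Fin d)}
  {φ ψ : EuclideanSpace ℝ (Fin d) → ℝ}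

/-- The integrand of the Lévy–Itô operator. -/
noncomputable def levyItoIntegrand
    (j : EuclideanSpace ℝ (Fin d) → EuclideanSpace ℝ (Fin d) → EuclideanSpace ℝ (Fin d))
    (φ : EuclideanSpace ℝ (Fin d) → ℝ) (x z : EuclideanSpace ℝ (Fin d)) : ℝ :=
  φ (x + j x z) - φ x - ⟪gradient φ x, j x z⟫ *
    (closedBall (0 : EuclideanSpace ℝ (Fin d)) 1).indicator (fun _ => (1 : ℝ)) z

theorem continuous_gradient (hφ : ContDiff ℝ 2 φ) : Continuous (gradient φ) :=
  (InnerProductSpace.toDual ℝ _).symm.continuous.comp (hφ.continuous_fderiv (by norm_num))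

theorem integrable_min_sq_one (hμ : ∫⁻ z, ENNReal.ofReal (min (‖z‖ ^ 2) 1) ∂μ < ⊤) :
    Integrable (fun z => min (‖z‖ ^ 2) 1) μ := by
  refine ⟨(by fun_prop : Continuous _).aestronglyMeasurable, ?_⟩
  rw [hasFiniteIntegral_iff_ofReal (Eventually.of_forall fun z => by positivity)]
  exact hμ

theorem aestronglyMeasurable_levyItoIntegrand (hj : Measurable (Function.uncurry j))
    (hφ : ContDiff ℝ 2 φ) (x : EuclideanSpace ℝ (Fin d)) :
    AEStronglyMeasurable (levyItoIntegrand j φ x) μ := by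
  have hjx : Measurable fun z => j x z := hj.comp measurable_prodMk_left
  have h1 : Measurable fun z => φ (x + j x z) :=
    hφ.continuous.measurable.comp (measurable_const.add hjx)
  have h2 : Measurable fun z => ⟪gradient φ x, j x z⟫ := measurable_const.inner hjx
  exact ((h1.sub measurable_const).sub
    (h2.mul (measurable_const.indicator isClosed_closedBall.measurableSet))).aestronglyMeasurable

theorem exists_levyItoIntegrand_bound {c : ℝ} (hc : 0 ≤ c) (hj : ∀ x z, ‖j x z‖ ≤ c * ‖z‖)
    (hφ : ContDiff ℝ 2 φ) (hφb : ∃ C, ∀ y, |φ y| ≤ C) (x : EuclideanSpace ℝ (Fin d)) :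
    ∃ K, ∀ y ∈ ball x 1, ∀ z, ‖levyItoIntegrand j φ y z‖ ≤ K * min (‖z‖ ^ 2) 1 := by
  obtain ⟨C, hC⟩ := hφb
  obtain ⟨L, hL, hLb⟩ := exists_taylor_bound_closedBall hφ x (1 + c)
  refine ⟨max (2 * C) (L * c ^ 2), fun y hy z => ?_⟩
  rw [mem_ball] at hy
  by_cases hz : ‖z‖ ≤ 1
  · have hz' : z ∈ closedBall (0 : EuclideanSpace ℝ (Fin d)) 1 := by simpa using hz
    have hjz : ‖j y z‖ ≤ c := (hj y z).trans (mul_le_of_le_one_right hc hz)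
    have hyj : y + j y z ∈ closedBall x (1 + c) := by
      rw [mem_closedBall, dist_eq_norm, add_sub_right_comm]
      rw [dist_eq_norm] at hy
      exact (norm_add_le _ _).trans (add_le_add hy.le hjz)
    have h := hLb y (by rw [mem_closedBall]; linarith) _ hyj
    rw [levyItoIntegrand, Set.indicator_of_mem hz', mul_one, inner_gradient_left,
      min_eq_left (pow_le_one₀ (norm_nonneg z) hz)]
    calc _ ≤ L * ‖j y z‖ ^ 2 := h
      _ ≤ L * (c * ‖z‖) ^ 2 := by gcongr; exact hj y z
      _ = L * c ^ 2 * ‖z‖ ^ 2 := by ring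
      _ ≤ _ := by gcongr; exact le_max_right _ _
  · have hz' : z ∉ closedBall (0 : EuclideanSpace ℝ (Fin d)) 1 := by simpa using hz
    rw [levyItoIntegrand, Set.indicator_of_notMem hz', mul_zero, sub_zero,
      min_eq_right (one_le_pow₀ (not_le.1 hz).le), mul_one]
    refine le_trans ?_ (le_max_left _ _)
    refine (norm_sub_le _ _).trans ?_
    have h1 := hC (y + j y z)
    have h2 := hC y
    rw [Real.norm_eq_abs, Real.norm_eq_abs]
    linarith

theorem integrable_levyItoIntegrand (hμ : ∫⁻ z, ENNReal.ofReal (min (‖z‖ ^ 2) 1) ∂μ < ⊤)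
    {c : ℝ} (hc : 0 ≤ c) (hjm : Measurable (Function.uncurry j)) (hj : ∀ x z, ‖j x z‖ ≤ c * ‖z‖)
    (hφ : ContDiff ℝ 2 φ) (hφb : ∃ C, ∀ y, |φ y| ≤ C) (x : EuclideanSpace ℝ (Fin d)) :
    Integrable (levyItoIntegrand j φ x) μ := by
  obtain ⟨K, hK⟩ := exists_levyItoIntegrand_bound hc hj hφ hφb x
  exact ((integrable_min_sq_one hμ).const_mul K).mono'
    (aestronglyMeasurable_levyItoIntegrand hjm hφ x)
    (Eventually.of_forall (hK x (mem_ball_self one_pos)))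

theorem continuous_ILI (hμ : ∫⁻ z, ENNReal.ofReal (min (‖z‖ ^ 2) 1) ∂μ < ⊤)
    {c : ℝ} (hc : 0 ≤ c) (hjm : Measurable (Function.uncurry j)) (hj : ∀ x z, ‖j x z‖ ≤ c * ‖z‖)
    (hjc : ∀ z, Continuous fun x => j x z)
    (hφ : ContDiff ℝ 2 φ) (hφb : ∃ C, ∀ y, |φ y| ≤ C) : Continuous fun x => ILI μ j x φ := by
  refine continuous_iff_continuousAt.2 fun x => ?_
  obtain ⟨K, hK⟩ := exists_levyItoIntegrand_bound hc hj hφ hφb x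
  refine continuousAt_of_dominated (F := levyItoIntegrand j φ)
    (Eventually.of_forall (aestronglyMeasurable_levyItoIntegrand hjm hφ))
    (eventually_of_mem (ball_mem_nhds x one_pos) fun y hy => Eventually.of_forall (hK y hy))
    ((integrable_min_sq_one hμ).const_mul K) (Eventually.of_forall fun z => ?_)
  have h1 := hφ.continuous
  have h2 := hjc z
  have h3 := continuous_gradient hφ
  refine Continuous.continuousAt ?_
  unfold levyItoIntegrand
  fun_prop

theorem gradient_add_const_mul (hφ : ContDiff ℝ 2 φ) (hψ : ContDiff ℝ 2 ψ) (δ : ℝ)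
    (x : EuclideanSpace ℝ (Fin d)) :
    gradient (fun y => φ y + δ * ψ y) x = gradient φ x + δ • gradient ψ x := by
  have h1 := (hφ.differentiable (by norm_num)).differentiableAt (x := x)
  have h2 := (hψ.differentiable (by norm_num)).differentiableAt (x := x)
  rw [gradient, gradient, gradient, fderiv_fun_add h1 (h2.const_mul δ), fderiv_const_mul h2,
    map_add, LinearIsometryEquiv.map_smulₛₗ]
  simp

theorem hessM_add_const_mul (hφ : ContDiff ℝ 2 φ) (hψ : ContDiff ℝ 2 ψ) (δ : ℝ)
    (x : EuclideanSpace ℝ (Fin d)) :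
    hessM (fun y => φ y + δ * ψ y) x = hessM φ x + δ • hessM ψ x := by
  have h : (fun y => φ y + δ * ψ y) = φ + δ • ψ := rfl
  ext k l
  simp only [hessM, Matrix.of_apply, Matrix.add_apply, Matrix.smul_apply]
  have hδψ : ContDiff ℝ 2 (δ • ψ) := hψ.const_smul δ
  rw [h, iteratedFDeriv_add_apply hφ.contDiffAt hδψ.contDiffAt,
    iteratedFDeriv_const_smul_apply hψ.contDiffAt]
  rfl

theorem continuous_hessM (hφ : ContDiff ℝ 2 φ) : Continuous (hessM φ) := by
  have h : Continuous fun x => iteratedFDeriv ℝ 2 φ x := hφ.continuous_iteratedFDeriv le_rfl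
  refine continuous_matrix fun k l => ?_
  exact (ContinuousMultilinearMap.apply ℝ _ ℝ _).continuous.comp h

theorem ILI_add_const_mul (hμ : ∫⁻ z, ENNReal.ofReal (min (‖z‖ ^ 2) 1) ∂μ < ⊤)
    {c : ℝ} (hc : 0 ≤ c) (hjm : Measurable (Function.uncurry j)) (hj : ∀ x z, ‖j x z‖ ≤ c * ‖z‖)
    (hφ : ContDiff ℝ 2 φ) (hφb : ∃ C, ∀ y, |φ y| ≤ C)
    (hψ : ContDiff ℝ 2 ψ) (hψb : ∃ C, ∀ y, |ψ y| ≤ C) (δ : ℝ) (x : EuclideanSpace ℝ (Fin d)) :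
    ILI μ j x (fun y => φ y + δ * ψ y) = ILI μ j x φ + δ * ILI μ j x ψ := by
  have h1 := integrable_levyItoIntegrand hμ hc hjm hj hφ hφb x
  have h2 := integrable_levyItoIntegrand hμ hc hjm hj hψ hψb x
  have h3 := integral_add h1 (h2.const_mul δ)
  rw [integral_const_mul] at h3
  refine Eq.trans (integral_congr_ae (Eventually.of_forall fun z => ?_)) h3
  simp only [levyItoIntegrand]
  rw [gradient_add_const_mul hφ hψ, inner_add_left, real_inner_smul_left]
  ring

end LevyIto

/-- If nonpositive values of a locally uniformly bounded family occur arbitrarily close to `ξ`, then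
the lower semicontinuous envelope of its infimum is nonpositive at `ξ`. -/
theorem liminf_iInf_nonpos {X ι : Type*} [TopologicalSpace X] {f : ι → X → ℝ} {ξ : X}
    {K : Set X} (hK : K ∈ 𝓝 ξ) {C : ℝ} (hC : ∀ i, ∀ ζ ∈ K, |f i ζ| ≤ C)
    (hf : ∃ᶠ ζ in 𝓝 ξ, ∃ i, f i ζ ≤ 0) : liminf (fun ζ => ⨅ i, f i ζ) (𝓝 ξ) ≤ 0 := by
  obtain ⟨_, i₀, _⟩ := hf.exists
  have : Nonempty ι := ⟨i₀⟩
  refine liminf_le_of_frequently_le ((hf.and_eventually hK).mono ?_) ?_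
  · rintro ζ ⟨⟨i, hi⟩, hζ⟩
    refine (ciInf_le ⟨-C, ?_⟩ i).trans hi
    rintro _ ⟨k, rfl⟩
    exact (abs_le.1 (hC k ζ hζ)).1
  · exact ⟨-C, eventually_map.2
      (eventually_of_mem hK fun ζ hζ => le_ciInf fun i => (abs_le.1 (hC i ζ hζ)).1)⟩

section RelaxedSup

variable {X ι : Type*} [TopologicalSpace X] {u : ι → X → ℝ} {c : ℝ}

theorem le_limsup_iSup (hc : ∀ i y, u i y ≤ c) (i : ι) (x : X) :
    u i x ≤ limsup (fun y => ⨆ i, u i y) (𝓝 x) := by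
  have : Nonempty ι := ⟨i⟩
  have hbdd : ∀ y, BddAbove (Set.range fun i => u i y) := fun y =>
    ⟨c, by rintro _ ⟨k, rfl⟩; exact hc k y⟩
  refine le_limsup_of_frequently_le ?_ ⟨c, eventually_map.2
    (Eventually.of_forall fun y => ciSup_le fun k => hc k y)⟩
  exact frequently_iff.2 fun hU => ⟨x, mem_of_mem_nhds hU, le_ciSup (hbdd x) i⟩

theorem frequently_exists_lt_of_lt_limsup_iSup [Nonempty ι] (hc : ∀ i y, u i y ≤ c)
    (hb : ∃ i m, ∀ y, m ≤ u i y) {x : X} {b : ℝ} (h : b < limsup (fun y => ⨆ i, u i y) (𝓝 x)) :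
    ∃ᶠ y in 𝓝 x, ∃ i, b < u i y := by
  obtain ⟨i, m, hm⟩ := hb
  have hbdd : ∀ y, BddAbove (Set.range fun i => u i y) := fun y =>
    ⟨c, by rintro _ ⟨k, rfl⟩; exact hc k y⟩
  have hcob : IsCoboundedUnder (· ≤ ·) (𝓝 x) fun y => ⨆ i, u i y :=
    IsBoundedUnder.isCoboundedUnder_le ⟨m, eventually_map.2
      (Eventually.of_forall fun y => (hm y).trans (le_ciSup (hbdd y) i))⟩
  exact (frequently_lt_of_lt_limsup hcob h).mono fun y hy => exists_lt_of_lt_ciSup hy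

end RelaxedSup

/-- stability of the supremum of a family of viscosity subsolutions. -/
theorem statement11 {d : ℕ} (μ : Measure (EuclideanSpace ℝ (Fin d)))
    (hLevy : ∫⁻ z, ENNReal.ofReal (min (‖z‖ ^ 2) 1) ∂μ < ⊤)
    (cb : ℝ) (hcb : 0 < cb)
    (j : EuclideanSpace ℝ (Fin d) → EuclideanSpace ℝ (Fin d) → EuclideanSpace ℝ (Fin d))
    (hjm : Measurable (Function.uncurry j))
    (hjb : ∀ x z, ‖j x z‖ ≤ cb * ‖z‖)
    (hjc : ∀ z, Continuous fun x => j x z)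
    (A : Type) (hA : Nonempty A)
    (F : A → EuclideanSpace ℝ (Fin d) → ℝ → EuclideanSpace ℝ (Fin d) →
      Matrix (Fin d) (Fin d) ℝ → ℝ → ℝ)
    (hFc : ∀ a : A,
      Continuous fun ξ : EuclideanSpace ℝ (Fin d) × ℝ × EuclideanSpace ℝ (Fin d) ×
        Matrix (Fin d) (Fin d) ℝ × ℝ => F a ξ.1 ξ.2.1 ξ.2.2.1 ξ.2.2.2.1 ξ.2.2.2.2)
    (hFe : ∀ a : A, DegEll (F a))
    (hFb : ∀ K : Set (EuclideanSpace ℝ (Fin d) × ℝ × EuclideanSpace ℝ (Fin d) ×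
        Matrix (Fin d) (Fin d) ℝ × ℝ), IsCompact K →
      ∃ C : ℝ, ∀ a : A, ∀ ξ ∈ K, |F a ξ.1 ξ.2.1 ξ.2.2.1 ξ.2.2.2.1 ξ.2.2.2.2| ≤ C)
    (ua : A → EuclideanSpace ℝ (Fin d) → ℝ)
    (huab : ∀ a : A, ∃ C, ∀ x, |ua a x| ≤ C)
    (huusc : ∀ a : A, UpperSemicontinuous (ua a))
    (husub : ∀ a : A, IsSubsolution (F a) μ j (ua a))
    (cb' : ℝ) (hub' : ∀ (a : A) x, ua a x ≤ cb')
    (ustar : EuclideanSpace ℝ (Fin d) → ℝ)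
    (hustar : ustar = fun x => Filter.limsup (fun y => ⨆ a : A, ua a y) (𝓝 x))
    (Flow : EuclideanSpace ℝ (Fin d) → ℝ → EuclideanSpace ℝ (Fin d) →
      Matrix (Fin d) (Fin d) ℝ → ℝ → ℝ)
    (hFlow : ∀ x a p X l, Flow x a p X l = Filter.liminf
      (fun ζ : EuclideanSpace ℝ (Fin d) × ℝ × EuclideanSpace ℝ (Fin d) ×
          Matrix (Fin d) (Fin d) ℝ × ℝ =>
        ⨅ b : A, F b ζ.1 ζ.2.1 ζ.2.2.1 ζ.2.2.2.1 ζ.2.2.2.2)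
      (𝓝 (x, a, p, X, l))) :
    IsSubsolution Flow μ j ustar := by
  intro φ hφ hφb x hmax
  have hη : ContDiff ℝ 2 (smoothPenalty x) := contDiff_smoothPenalty x
  have hηb : ∃ C, ∀ y, |smoothPenalty x y| ≤ C := ⟨1, abs_smoothPenalty_le_one x⟩
  have hle : ∀ a y, ua a y ≤ ustar y := fun a y => by
    rw [hustar]; exact le_limsup_iSup hub' a y
  have happ : ∀ ε > 0, ∃ᶠ y in 𝓝 x, ∃ a, ustar x - ε < ua a y := fun ε hε => by
    obtain ⟨a⟩ := id hA
    obtain ⟨C, hC⟩ := huab a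
    refine frequently_exists_lt_of_lt_limsup_iSup hub' ⟨a, -C, fun y => (abs_le.1 (hC y)).1⟩ ?_
    rw [hustar]
    linarith
  rw [hFlow]
  have : LocallyCompactSpace (Matrix (Fin d) (Fin d) ℝ) :=
    inferInstanceAs (LocallyCompactSpace (Fin d → Fin d → ℝ))
  obtain ⟨K, hKc, hK⟩ := exists_compact_mem_nhds
    (x, ustar x, gradient φ x, hessM φ x, ILI μ j x φ)
  obtain ⟨C, hC⟩ := hFb K hKc
  refine liminf_iInf_nonpos hK hC ?_
  let T : EuclideanSpace ℝ (Fin d) × ℝ × ℝ → EuclideanSpace ℝ (Fin d) × ℝ ×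
      EuclideanSpace ℝ (Fin d) × Matrix (Fin d) (Fin d) ℝ × ℝ := fun q =>
    (q.1, q.2.1, gradient φ q.1 + q.2.2 • gradient (smoothPenalty x) q.1,
      hessM φ q.1 + q.2.2 • hessM (smoothPenalty x) q.1,
      ILI μ j q.1 φ + q.2.2 * ILI μ j q.1 (smoothPenalty x))
  have hT : Continuous T := by
    have h1 := continuous_gradient hφ
    have h2 := continuous_gradient hη
    have h3 := continuous_hessM hφ
    have h4 := continuous_hessM hη
    have h5 := continuous_ILI hLevy hcb.le hjm hjb hjc hφ hφb
    have h6 := continuous_ILI hLevy hcb.le hjm hjb hjc hη hηb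
    fun_prop
  have hT0 : T (x, ustar x, 0) = (x, ustar x, gradient φ x, hessM φ x, ILI μ j x φ) := by
    simp [T]
  rw [← hT0]
  refine hT.continuousAt.tendsto.frequently ?_
  rw [frequently_iff]
  intro V hV
  obtain ⟨ε, hε, hεV⟩ := Metric.mem_nhds_iff.1 hV
  obtain ⟨a, x', hx', hux', hax'⟩ := exists_isMax_sub_perturbation huusc hle happ hφ.continuous
    hη.continuous (smoothPenalty_nonneg x) (smoothPenalty_self x)
    (fun r hr => ⟨r ^ 2 / (1 + r ^ 2), by positivity, fun y => le_smoothPenalty hr.le⟩) hmax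
    (half_pos hε) hε
  refine ⟨(x', ua a x', ε / 2), hεV ?_, a, ?_⟩
  · simp only [mem_ball, Prod.dist_eq, Real.dist_eq, sub_zero, abs_of_pos (half_pos hε)]
    exact max_lt hx' (max_lt hux' (half_lt_self hε))
  · have hψb : ∃ C, ∀ y, |φ y + ε / 2 * smoothPenalty x y| ≤ C := by
      obtain ⟨C, hC⟩ := hφb
      refine ⟨C + ε / 2 * 1, fun y => (abs_add_le _ _).trans (add_le_add (hC y) ?_)⟩
      rw [abs_mul, abs_of_pos (half_pos hε)]
      exact mul_le_mul_of_nonneg_left (abs_smoothPenalty_le_one x y) (half_pos hε).le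
    have h := husub a (fun y => φ y + ε / 2 * smoothPenalty x y)
      (hφ.add (contDiff_const.mul hη)) hψb x' hax'
    rw [gradient_add_const_mul hφ hη, hessM_add_const_mul hφ hη,
      ILI_add_const_mul hLevy hcb.le hjm hjb hφ hφb hη hηb] at h
    exact h
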